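/- arXiv:1002.2797 — 2 statements merged into one kernel-verified Lean document; each statement's English description precedes it below -/
import Mathlib

section
/- Let p be a prime, e ≥ 2 an integer, j the smallest positive integer such that e divides p^j + 1, and q = p^{2jγ} with γ ≥ 1. If it is not the case that γ, p, and (p^j+1)/e are all odd, then the cyclotomic periods of order e of F_q satisfy η_0 = −(−1)^γ √q + ((−1)^γ √q − 1)/e and η_i = ((−1)^γ √q − 1)/e for all i ≠ 0, where √q = p^{jγ}. -/
open Finset

noncomputable section
open scoped Classical

/-- `D` is a `(v,k,λ,μ)` partial difference set in the finite abelian group `G`: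
every nonzero element of `D` is a difference of elements of `D` in exactly `λ` ways,
and every nonzero element outside `D` in exactly `μ` ways. -/
def IsPDS {G : Type*} [AddCommGroup G] [Fintype G] (D : Finset G) (v k lam mu : ℤ) : Prop :=
  (Fintype.card G : ℤ) = v ∧ (D.card : ℤ) = k ∧
    ∀ g : G, g ≠ 0 →
      ((((D ×ˢ D).filter fun xy => xy.1 - xy.2 = g).card : ℤ) = if g ∈ D then lam else mu)

noncomputable instance (p n : ℕ) [Fact p.Prime] : Fintype (GaloisField p n) :=
  Fintype.ofFinite _

/-- The canonical additive character `ψ₁(x) = ω_p^{Tr(x)}` of `F_{p^n}`,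
where `ω_p = exp(2πi/p)` and `Tr` is the absolute trace. -/
def psi (p n : ℕ) [Fact p.Prime] (x : GaloisField p n) : ℂ :=
  Complex.exp (2 * Real.pi * Complex.I *
    ((Algebra.trace (ZMod p) (GaloisField p n) x).val : ℂ) / p)

/-- The cyclotomic class `C_i = {g^{i+ej} : 0 ≤ j ≤ f-1}` of order `e`
with respect to the primitive element `g`. -/
def cycClass (p n : ℕ) [Fact p.Prime] (g : GaloisField p n) (e f i : ℕ) :
    Finset (GaloisField p n) :=
  (Finset.range f).image fun j => g ^ (i + e * j)

/-- The polar form `B(x,y) = Q(x+y) − Q(x) − Q(y)` of `Q`. -/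
def polarForm {F V : Type*} [Field F] [AddCommGroup V] (Q : V → F) (x y : V) : F :=
  Q (x + y) - Q x - Q y

/-- Splitting an initial segment of length `a * b` into the residue classes modulo `a`. -/
lemma sum_range_mul_eq_sum_residues {M : Type*} [AddCommMonoid M] (h : ℕ → M) (a b : ℕ) :
    ∑ k ∈ range (a * b), h k = ∑ r ∈ range a, ∑ k ∈ range b, h (r + a * k) := by
  induction b with
  | zero => simp
  | succ b ih =>
    rw [Nat.mul_succ, sum_range_add, ih, ← sum_add_distrib]
    refine sum_congr rfl fun r _ => ?_
    rw [sum_range_succ, add_comm r (a * b)]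

lemma sum_range_mul_of_periodic {M : Type*} [AddCommMonoid M] (h : ℕ → M) (a b : ℕ)
    (hh : ∀ k, h (a + k) = h k) :
    ∑ k ∈ range (b * a), h k = b • ∑ k ∈ range a, h k := by
  induction b with
  | zero => simp
  | succ b ih =>
    rw [Nat.succ_mul, add_comm, sum_range_add, sum_congr rfl fun k _ => hh k, ih, succ_nsmul']

lemma sum_range_mul_of_antiperiodic {R : Type*} [Ring R] (h : ℕ → R) (a b : ℕ)
    (hh : ∀ k, h (a + k) = -h k) :
    ∑ k ∈ range (2 * a * b), h k = 0 := by
  rw [mul_comm, sum_range_mul_of_periodic h (2 * a) b fun k => by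
    rw [two_mul, add_assoc, hh, hh, neg_neg], two_mul, sum_range_add,
    sum_congr rfl fun k _ => hh k]
  simp

/-- The trace of `x ^ p ^ j` is the trace of `x`. -/
lemma trace_pow_char_pow {p : ℕ} [Fact p.Prime] {F : Type*} [Field F] [Finite F]
    [Algebra (ZMod p) F] (j : ℕ) (x : F) :
    Algebra.trace (ZMod p) F (x ^ p ^ j) = Algebra.trace (ZMod p) F x := by
  induction j with
  | zero => simp
  | succ j ih =>
    rw [pow_succ, pow_mul, ← ih]
    simpa [ZMod.card] using
      Algebra.trace_eq_of_algEquiv (FiniteField.frobeniusAlgEquivOfAlgebraic (ZMod p) F)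
        (x ^ p ^ j)

lemma neg_pow_char_pow {p : ℕ} [Fact p.Prime] {F : Type*} [Field F] [CharP F p] (j : ℕ) (x : F) :
    (-x) ^ p ^ j = -x ^ p ^ j := by
  simpa [iterateFrobenius_def] using map_neg (iterateFrobenius F p j) x

lemma trace_eq_zero_of_pow_eq_neg {p : ℕ} [Fact p.Prime] {F : Type*} [Field F] [Finite F]
    [Algebra (ZMod p) F] [CharP F p] (j γ : ℕ) (hF : Module.finrank (ZMod p) F = 2 * j * γ)
    {z : F} (hz : z ^ p ^ j = -z) :
    Algebra.trace (ZMod p) F z = 0 := by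
  apply (algebraMap (ZMod p) F).injective
  rw [FiniteField.algebraMap_trace_eq_sum_pow, hF, map_zero, Nat.card_zmod]
  refine sum_range_mul_of_antiperiodic _ j γ fun k => ?_
  rw [pow_add, pow_mul, hz, neg_pow_char_pow]

/-- The square of the exponential sum of the Hermitian form `a * x ^ (Q + 1)` is the order of the
field times the size of the radical of the form. -/
lemma sq_sum_hermitian {p : ℕ} [Fact p.Prime] {F : Type*} [Field F] [Fintype F] [CharP F p]
    {ψ : AddChar F ℂ} (hψ : ψ.IsPrimitive) (j : ℕ)
    (hfrob : ∀ x, ψ (x ^ p ^ j) = ψ x) (hneg : ∀ z, z ^ p ^ j = -z → ψ z = 1)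
    {c : F} (hc : c ^ (p ^ j + 1) = -1) (a : F) :
    (∑ x, ψ (a * x ^ (p ^ j + 1))) ^ 2 =
      Fintype.card F * #{x : F | a ^ p ^ j * (x ^ p ^ j) ^ p ^ j + a * x = 0} := by
  have hc0 : c ≠ 0 := by rintro rfl; simp at hc
  have hS : ∑ x, ψ (a * x ^ (p ^ j + 1)) = ∑ x, ψ (-(a * x ^ (p ^ j + 1))) := by
    rw [← Equiv.sum_comp (Equiv.mulLeft₀ c hc0)]
    simp [mul_pow, hc]
  have hbij : Function.Bijective fun y : F => y ^ p ^ j := by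
    refine Finite.injective_iff_bijective.mp fun x y h => ?_
    exact iterateFrobenius_inj F p j (by simpa [iterateFrobenius_def] using h)
  have hexp (x y : F) : ψ (a * (x + y) ^ (p ^ j + 1)) * ψ (-(a * y ^ (p ^ j + 1))) =
      ψ (a * x ^ (p ^ j + 1)) * ψ (y ^ p ^ j * (a ^ p ^ j * (x ^ p ^ j) ^ p ^ j + a * x)) := by
    have h1 : ψ (y ^ p ^ j * (a ^ p ^ j * (x ^ p ^ j) ^ p ^ j + a * x)) =
        ψ (a * x ^ p ^ j * y + a * x * y ^ p ^ j) := by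
      rw [ψ.map_add_eq_mul, ← hfrob (a * x ^ p ^ j * y), ← ψ.map_add_eq_mul]
      congr 1
      rw [mul_pow, mul_pow]
      ring
    rw [h1, ← ψ.map_add_eq_mul, ← ψ.map_add_eq_mul]
    congr 1
    rw [pow_succ, add_pow_char_pow]
    ring
  calc (∑ x, ψ (a * x ^ (p ^ j + 1))) ^ 2
      = ∑ y, ∑ x, ψ (a * (x + y) ^ (p ^ j + 1)) * ψ (-(a * y ^ (p ^ j + 1))) := by
        rw [sq]
        conv_lhs => rw [mul_comm]; arg 1; rw [hS]
        rw [sum_mul]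
        refine sum_congr rfl fun y _ => ?_
        rw [← Equiv.sum_comp (Equiv.addRight y), mul_sum]
        exact sum_congr rfl fun x _ => mul_comm _ _
    _ = ∑ x, ψ (a * x ^ (p ^ j + 1)) *
          ∑ y, ψ (y ^ p ^ j * (a ^ p ^ j * (x ^ p ^ j) ^ p ^ j + a * x)) := by
        rw [sum_comm]
        simp only [hexp, mul_sum]
    _ = ∑ x, if a ^ p ^ j * (x ^ p ^ j) ^ p ^ j + a * x = 0 then (Fintype.card F : ℂ) else 0 := by
        refine sum_congr rfl fun x _ => ?_
        rw [hbij.sum_comp fun y => ψ (y * (a ^ p ^ j * (x ^ p ^ j) ^ p ^ j + a * x)),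
          AddChar.sum_mulShift _ hψ]
        split_ifs with h
        · rw [hneg, one_mul]
          rw [mul_pow, pow_succ, mul_pow]
          linear_combination x ^ p ^ j * h
        · simp
    _ = _ := by
        rw [← sum_filter, sum_const, nsmul_eq_mul, mul_comm]

/-- The size of the radical of the Hermitian form with coefficient `u ^ i`. -/
lemma card_hermitian_radical {F : Type*} [Field F] [Fintype F] {u : Fˣ}
    (hu : ∀ x : Fˣ, ∃ k : ℕ, u ^ k = x) {Q R : ℕ} (hQ : 2 ≤ Q)
    (hord : orderOf u = (Q - 1) * ((Q + 1) * R)) {m : ℕ}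
    (hm : u ^ (m * (Q - 1)) = -1) (i : ℕ) :
    #{x : F | ((u : F) ^ i) ^ Q * (x ^ Q) ^ Q + (u : F) ^ i * x = 0} =
      if i ≡ m [MOD Q + 1] then Q ^ 2 else 1 := by
  obtain ⟨k, rfl⟩ : ∃ k, Q = k + 1 := ⟨Q - 1, by omega⟩
  simp only [Nat.add_sub_cancel] at *
  have hk : 0 < k := by omega
  have hprim : IsPrimitiveRoot ((u : F) ^ R) (k * (k + 1 + 1)) := by
    have : IsPrimitiveRoot (u : F) (orderOf u) := by
      rw [IsPrimitiveRoot.coe_units_iff]; exact IsPrimitiveRoot.orderOf u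
    refine this.pow (orderOf_pos u) ?_
    rw [hord]; ring
  set d : F := -((u : F) ^ (i * k))⁻¹ with hd
  have hd0 : d ≠ 0 := by simp [hd]
  have hfil : ({x : F | ((u : F) ^ i) ^ (k + 1) * (x ^ (k + 1)) ^ (k + 1) + (u : F) ^ i * x = 0}
      : Finset F) = insert 0 (Polynomial.nthRoots (k * (k + 1 + 1)) d).toFinset := by
    ext x
    rw [mem_filter, mem_insert, Multiset.mem_toFinset, Polynomial.mem_nthRoots (by positivity)]
    have : ((u : F) ^ i) ^ (k + 1) * (x ^ (k + 1)) ^ (k + 1) + (u : F) ^ i * x =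
        x * ((u : F) ^ i * (u : F) ^ (i * k)) * (x ^ (k * (k + 1 + 1)) - d) := by
      have : (u : F) ^ (i * k) * d = -1 := by simp [hd]
      linear_combination x * (u : F) ^ i * this
    rw [this, mul_eq_zero, mul_eq_zero, sub_eq_zero]
    simp
  have hex : (∃ α : F, α ^ (k * (k + 1 + 1)) = d) ↔ i ≡ m [MOD k + 1 + 1] := by
    constructor
    · rintro ⟨α, hα⟩
      have hα0 : α ≠ 0 := by
        rintro rfl
        rw [zero_pow (by positivity)] at hα
        exact hd0 hα.symm
      obtain ⟨n, hn⟩ := hu (Units.mk0 α hα0)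
      have h1 : u ^ ((n * (k + 1 + 1) + i) * k) = u ^ (m * k) := by
        rw [hm]
        ext
        have : α = (u : F) ^ n := by rw [← Units.val_pow_eq_pow_val, hn]; rfl
        rw [this] at hα
        push_cast
        calc (u : F) ^ ((n * (k + 1 + 1) + i) * k)
            = ((u : F) ^ n) ^ (k * (k + 1 + 1)) * (u : F) ^ (i * k) := by ring
          _ = -1 := by rw [hα, hd]; simp
      rw [pow_eq_pow_iff_modEq, hord, mul_comm k] at h1
      have h2 := (Nat.ModEq.mul_right_cancel' (by omega) h1).of_mul_right R
      have h3 : n * (k + 1 + 1) + i ≡ i [MOD k + 1 + 1] := by simp [Nat.ModEq]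
      exact h3.symm.trans h2
    · intro h
      obtain ⟨c, hc⟩ := h.dvd
      refine ⟨((u ^ c : Fˣ) : F), ?_⟩
      have h1 : (u ^ c) ^ (k * (k + 1 + 1)) * u ^ (i * k) = -1 := by
        rw [← hm, ← zpow_natCast, ← zpow_mul, ← zpow_natCast, ← zpow_natCast, ← zpow_add]
        congr 1
        push_cast at hc ⊢
        linear_combination (-k : ℤ) * hc
      have h2 := congrArg (Units.val) h1
      push_cast at h2
      rw [hd, eq_neg_iff_add_eq_zero, ← mul_right_inj' (a := (u : F) ^ (i * k)) (by simp)]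
      rw [mul_add, mul_inv_cancel₀ (by simp)]
      push_cast
      linear_combination h2
  rw [hfil, card_insert_of_notMem, Multiset.card_toFinset,
    Multiset.dedup_eq_self.mpr (hprim.nthRoots_nodup hd0), hprim.card_nthRoots]
  · simp only [hex]
    split_ifs
    · ring
    · rfl
  · rw [Multiset.mem_toFinset, Polynomial.mem_nthRoots (by positivity), zero_pow (by positivity)]
    exact hd0.symm

lemma isIntegral_addChar {p : ℕ} [Fact p.Prime] {F : Type*} [Field F] [CharP F p]
    (ψ : AddChar F ℂ) (x : F) : IsIntegral ℤ (ψ x) := by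
  refine IsIntegral.of_pow (Nat.Prime.pos (Fact.out : p.Prime)) ?_
  rw [← ψ.map_nsmul_eq_pow]
  simpa using isIntegral_one

/-- A square root of `T ^ 2` that is congruent to `1` modulo `N ≥ 3` equals `T` if `T` is
congruent to `1` modulo `N`. -/
lemma eq_of_sq_eq_of_congr_one {N : ℕ} (hN : 3 ≤ N) {T : ℤ} (hT : (N : ℤ) ∣ T - 1) {S η : ℂ}
    (hη : IsIntegral ℤ η) (hS : 1 + N * η = S) (hsq : S ^ 2 = (T : ℂ) ^ 2) : S = T := by
  rcases sq_eq_sq_iff_eq_or_eq_neg.mp hsq with h | h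
  · exact h
  · exfalso
    have hN0 : (N : ℂ) ≠ 0 := by norm_cast; omega
    have hη' : η = algebraMap ℚ ℂ ((-T - 1) / N) := by
      simp only [map_div₀, map_sub, map_neg, map_one, map_intCast, map_natCast]
      rw [eq_div_iff hN0]
      linear_combination hS + h
    rw [hη', isIntegral_algebraMap_iff (algebraMap ℚ ℂ).injective,
      IsIntegrallyClosed.isIntegral_iff] at hη
    obtain ⟨y, hy⟩ := hη
    have hN1 : (N : ℚ) ≠ 0 := by norm_cast; omega
    rw [eq_div_iff hN1] at hy
    have hy' : y * N = -T - 1 := by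
      have : (y : ℚ) * N = -T - 1 := by simpa using hy
      exact_mod_cast this
    have h2 : (N : ℤ) ∣ 2 := by
      obtain ⟨t, ht⟩ := hT
      exact ⟨-t - y, by linear_combination hy' - ht⟩
    have := Int.le_of_dvd (by norm_num) h2
    omega

/-- A power sum over a finite field in terms of a cyclotomic period. -/
lemma sum_mul_pow_eq_period {F : Type*} [Field F] [Fintype F] {u : Fˣ}
    (hu : ∀ x : Fˣ, ∃ k : ℕ, u ^ k = x) {N f : ℕ} (hN : N ≠ 0) (hord : orderOf u = f * N)
    (ψ : AddChar F ℂ) (i : ℕ) :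
    1 + (N : ℂ) * ∑ k ∈ range f, ψ ((u : F) ^ (i + N * k)) = ∑ x, ψ ((u : F) ^ i * x ^ N) := by
  have hunits : ∑ x : Fˣ, ψ ((u : F) ^ i * (x : F) ^ N) =
      ∑ k ∈ range (N * f), ψ ((u : F) ^ (i + N * k)) := by
    symm
    refine sum_bij (fun k _ => u ^ k) (fun _ _ => mem_univ _) ?_ ?_ ?_
    · intro a ha b hb h
      rw [mem_range, mul_comm, ← hord] at ha hb
      exact pow_injOn_Iio_orderOf ha hb h
    · intro x _
      obtain ⟨k, rfl⟩ := hu x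
      refine ⟨k % orderOf u, ?_, pow_mod_orderOf u k⟩
      rw [mem_range, mul_comm, ← hord]
      exact Nat.mod_lt _ (orderOf_pos u)
    · intro k _
      congr 1
      push_cast
      ring
  have hper : (u : F) ^ (N * f) = 1 := by
    rw [mul_comm, ← hord, ← Units.val_pow_eq_pow_val, pow_orderOf_eq_one, Units.val_one]
  rw [Fintype.sum_eq_add_sum_compl (0 : F)]
  have hcompl : ∑ x ∈ ({0}ᶜ : Finset F), ψ ((u : F) ^ i * x ^ N) =
      ∑ x : Fˣ, ψ ((u : F) ^ i * (x : F) ^ N) := by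
    symm
    refine sum_bij (fun x _ => (x : F)) (by simp) (fun a _ b _ h => Units.ext h) ?_ (by simp)
    intro x hx
    exact ⟨Units.mk0 x (by simpa using hx), mem_univ _, rfl⟩
  rw [hcompl, hunits, sum_range_mul_of_periodic, nsmul_eq_mul]
  · simp [hN]
  · intro k
    rw [mul_add, ← add_assoc, add_right_comm, pow_add _ _ (N * f), hper, mul_one]

/-- The half power of a generator of the unit group is `-1`. -/
lemma pow_eq_neg_one_of_two_mul {F : Type*} [Field F] {u : Fˣ} {n : ℕ} (hn : n ≠ 0)
    (hord : orderOf u = 2 * n) : u ^ n = -1 := by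
  have h1 : ((u : F) ^ n) ^ 2 = 1 := by
    rw [← pow_mul, mul_comm, ← hord, ← Units.val_pow_eq_pow_val, pow_orderOf_eq_one, Units.val_one]
  ext
  rcases eq_or_eq_neg_of_sq_eq_sq _ 1 (h1.trans (one_pow 2).symm) with h | h
  · exfalso
    have h2 : u ^ n = 1 := by ext; simpa using h
    have := Nat.le_of_dvd (by omega) (orderOf_dvd_of_pow_eq_one h2)
    omega
  · simpa using h

/-- The periods of order `p ^ j + 1`. -/
lemma hermitian_period {p : ℕ} [Fact p.Prime] {F : Type*} [Field F] [Fintype F] [CharP F p]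
    {ψ : AddChar F ℂ} (hψ : ψ.IsPrimitive) {j γ R : ℕ} (hj : 0 < j)
    (hcard : Fintype.card F = p ^ (2 * j * γ))
    (hfrob : ∀ x, ψ (x ^ p ^ j) = ψ x) (hneg : ∀ z, z ^ p ^ j = -z → ψ z = 1)
    {c : F} (hc : c ^ (p ^ j + 1) = -1) {u : Fˣ} (hu : ∀ x : Fˣ, ∃ k : ℕ, u ^ k = x)
    (hord : orderOf u = (p ^ j - 1) * ((p ^ j + 1) * R)) {m : ℕ}
    (hm : u ^ (m * (p ^ j - 1)) = -1) (i : ℕ) :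
    ∑ k ∈ range ((p ^ j - 1) * R), ψ ((u : F) ^ (i + (p ^ j + 1) * k)) =
      ((-1) ^ γ * (p : ℂ) ^ (j * γ) - 1) / ((p ^ j + 1 : ℕ) : ℂ) +
        if i ≡ m [MOD p ^ j + 1] then -(-1) ^ γ * (p : ℂ) ^ (j * γ) else 0 := by
  have hQ : 2 ≤ p ^ j := (Fact.out : p.Prime).two_le.trans (Nat.le_self_pow hj.ne' p)
  have hsum := sum_mul_pow_eq_period hu (N := p ^ j + 1) (f := (p ^ j - 1) * R) (by omega)
    (by rw [hord]; ring) ψ i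
  have hint : IsIntegral ℤ (∑ k ∈ range ((p ^ j - 1) * R), ψ ((u : F) ^ (i + (p ^ j + 1) * k))) :=
    IsIntegral.sum _ fun k _ => isIntegral_addChar (p := p) ψ _
  have hsq := sq_sum_hermitian hψ j hfrob hneg hc ((u : F) ^ i)
  rw [card_hermitian_radical hu hQ hord hm i, hcard] at hsq
  have hcong (n : ℕ) : ((p ^ j + 1 : ℕ) : ℤ) ∣ (-(p : ℤ) ^ j) ^ n - 1 := by
    have h1 : ((p ^ j + 1 : ℕ) : ℤ) ∣ -(p : ℤ) ^ j - 1 := ⟨-1, by push_cast; ring⟩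
    have h2 := sub_dvd_pow_sub_pow (-(p : ℤ) ^ j) 1 n
    rw [one_pow] at h2
    exact h1.trans h2
  have hN0 : ((p ^ j + 1 : ℕ) : ℂ) ≠ 0 := by norm_cast
  have hpow (n : ℕ) : (-(p : ℂ) ^ j) ^ n = (-1) ^ n * (p : ℂ) ^ (j * n) := by
    rw [neg_pow, pow_mul]
  have hpow_sq (n : ℕ) : ((-(p : ℂ) ^ j) ^ n) ^ 2 = (p : ℂ) ^ (2 * j * n) := by
    rw [hpow, mul_pow, ← pow_mul, mul_comm n, pow_mul, neg_one_sq, one_pow, one_mul]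
    ring
  split_ifs at hsq ⊢ with h
  · have := eq_of_sq_eq_of_congr_one (by omega) (hcong (γ + 1)) hint hsum (by
      rw [hsq]
      push_cast
      rw [hpow_sq]
      ring)
    rw [← hsum] at this
    push_cast at this hN0 ⊢
    rw [pow_succ, hpow] at this
    field_simp
    linear_combination this
  · have := eq_of_sq_eq_of_congr_one (by omega) (hcong γ) hint hsum (by
      rw [hsq]
      push_cast
      rw [hpow_sq, mul_one])
    rw [← hsum] at this
    push_cast at this hN0 ⊢
    rw [hpow] at this
    field_simp
    linear_combination this

lemma sum_sq_pow_modEq_two {Q : ℕ} (hQ : Odd Q) (γ : ℕ) :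
    ∑ i ∈ range γ, (Q ^ 2) ^ i ≡ γ [MOD 2] := by
  induction γ with
  | zero => rfl
  | succ γ ih =>
    rw [sum_range_succ]
    refine ih.add ?_
    exact Nat.odd_iff.mp (hQ.pow.pow)

lemma pow_two_mul_sub_one_eq_mul {p j : ℕ} (hQ : 2 ≤ p ^ j) (γ : ℕ) :
    p ^ (2 * j * γ) - 1 =
      (p ^ j - 1) * ((p ^ j + 1) * ∑ i ∈ range γ, ((p ^ j) ^ 2) ^ i) := by
  have h1 := Nat.geomSum_eq (m := (p ^ j) ^ 2) (by nlinarith) γ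
  have h2 : (p ^ j) ^ 2 - 1 = (p ^ j - 1) * (p ^ j + 1) := by
    rw [mul_comm, ← Nat.sq_sub_sq, one_pow]
  have h3 : (p ^ j) ^ 2 - 1 ∣ ((p ^ j) ^ 2) ^ γ - 1 := by
    simpa using Nat.sub_dvd_pow_sub_pow ((p ^ j) ^ 2) 1 γ
  rw [← mul_assoc, ← h2, h1, Nat.mul_div_cancel' h3, mul_comm 2 j, pow_mul, pow_mul]

/-- In case B the exceptional class of order `Q + 1` lies in the class `0` of order `e`. -/
lemma exists_dvd_pow_eq_neg_one {F : Type*} [Field F] {p : ℕ} [Fact p.Prime] [CharP F p]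
    {u : Fˣ} {j γ e : ℕ} (hj : 0 < j) (hγ : 1 ≤ γ) (hje : e ∣ p ^ j + 1)
    (hcase : ¬(Odd γ ∧ Odd p ∧ Odd ((p ^ j + 1) / e)))
    (hord : orderOf u =
      (p ^ j - 1) * ((p ^ j + 1) * ∑ i ∈ range γ, ((p ^ j) ^ 2) ^ i)) :
    (∃ m, e ∣ m ∧ u ^ (m * (p ^ j - 1)) = -1) ∧ ∃ c : F, c ^ (p ^ j + 1) = -1 := by
  rcases (Fact.out : p.Prime).eq_two_or_odd' with rfl | hp
  · have h1 : (-1 : F) = 1 := CharTwo.neg_eq 1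
    exact ⟨⟨0, dvd_zero e, by ext; simp [h1]⟩, 1, by simp [h1]⟩
  · have hQ : Odd (p ^ j) := hp.pow
    have hQ3 : 3 ≤ p ^ j := by
      have : 2 ≤ p ^ j := (Fact.out : p.Prime).two_le.trans (Nat.le_self_pow hj.ne' p)
      obtain ⟨k, hk⟩ := hQ
      omega
    have hmod := sum_sq_pow_modEq_two hQ γ
    have hR : 0 < ∑ i ∈ range γ, ((p ^ j) ^ 2) ^ i :=
      sum_pos (fun _ _ => by positivity) ⟨0, mem_range.mpr hγ⟩
    set R := ∑ i ∈ range γ, ((p ^ j) ^ 2) ^ i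
    obtain ⟨k, hk⟩ := hQ
    rw [hk] at hord hje hcase ⊢
    have hk0 : 0 < k := by omega
    have hsub : 2 * k + 1 - 1 = 2 * k := rfl
    rw [hsub] at hord ⊢
    have hneg : u ^ (2 * k * ((k + 1) * R)) = -1 :=
      pow_eq_neg_one_of_two_mul (by positivity) (by rw [hord]; ring)
    refine ⟨⟨(k + 1) * R, ?_, by rw [mul_comm, hneg]⟩, (u : F) ^ (k * R), ?_⟩
    · obtain ⟨t, ht⟩ := hje
      rw [ht] at hcase
      rcases Nat.even_or_odd t with ⟨s, hs⟩ | ht'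
      · have : k + 1 = e * s := by
          rw [hs, mul_add] at ht
          omega
        rw [this, mul_assoc]
        exact dvd_mul_right _ _
      · have he : 0 < e := by
          rcases Nat.eq_zero_or_pos e with rfl | h
          · simp at ht
          · exact h
        have hγ' : ¬Odd γ := fun h => hcase ⟨h, hp, by rwa [Nat.mul_div_cancel_left _ he]⟩
        have hR2 : R % 2 = 0 := Eq.trans hmod (Nat.even_iff.mp (Nat.not_odd_iff_even.mp hγ'))
        obtain ⟨s, hs⟩ := Nat.dvd_of_mod_eq_zero hR2
        refine ⟨t * s, ?_⟩
        rw [hs]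
        linear_combination s * ht
    · rw [← pow_mul, ← Units.val_pow_eq_pow_val,
        show k * R * (2 * k + 1 + 1) = 2 * k * ((k + 1) * R) by ring, hneg]
      simp

/-- The periods of order `e` in case B, with respect to any additive character that is invariant
under `x ↦ x ^ p ^ j` and trivial on the solutions of `z ^ p ^ j = -z`. -/
lemma uniform_period {p : ℕ} [Fact p.Prime] {F : Type*} [Field F] [Fintype F] [CharP F p]
    {ψ : AddChar F ℂ} (hψ : ψ.IsPrimitive) {j γ e : ℕ} (hj : 0 < j) (hγ : 1 ≤ γ)
    (hje : e ∣ p ^ j + 1) (hcase : ¬(Odd γ ∧ Odd p ∧ Odd ((p ^ j + 1) / e)))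
    (hcard : Fintype.card F = p ^ (2 * j * γ))
    (hfrob : ∀ x, ψ (x ^ p ^ j) = ψ x) (hneg : ∀ z, z ^ p ^ j = -z → ψ z = 1)
    {u : Fˣ} (hu : ∀ x : Fˣ, ∃ k : ℕ, u ^ k = x) (hord : orderOf u = p ^ (2 * j * γ) - 1)
    {i : ℕ} (hi : i < e) :
    ∑ k ∈ range ((p ^ (2 * j * γ) - 1) / e), ψ ((u : F) ^ (i + e * k)) =
      ((-1) ^ γ * (p : ℂ) ^ (j * γ) - 1) / e +
        if i = 0 then -(-1) ^ γ * (p : ℂ) ^ (j * γ) else 0 := by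
  have hQ : 2 ≤ p ^ j := (Fact.out : p.Prime).two_le.trans (Nat.le_self_pow hj.ne' p)
  have hfac := pow_two_mul_sub_one_eq_mul hQ γ
  obtain ⟨⟨m, hem, hm⟩, c, hc⟩ := exists_dvd_pow_eq_neg_one hj hγ hje hcase (hord.trans hfac)
  have hperiod := hermitian_period hψ hj hcard hfrob hneg hc hu (hord.trans hfac) hm
  set R := ∑ i ∈ range γ, ((p ^ j) ^ 2) ^ i
  have he : 0 < e := by omega
  obtain ⟨t, ht⟩ := hje
  have hf : (p ^ (2 * j * γ) - 1) / e = t * ((p ^ j - 1) * R) := by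
    rw [hfac, ht, show (p ^ j - 1) * (e * t * R) = e * (t * ((p ^ j - 1) * R)) by ring,
      Nat.mul_div_cancel_left _ he]
  rw [hf, sum_range_mul_eq_sum_residues]
  have hterm (r : ℕ) : ∑ k ∈ range ((p ^ j - 1) * R), ψ ((u : F) ^ (i + e * (r + t * k))) =
      ((-1) ^ γ * (p : ℂ) ^ (j * γ) - 1) / ((e * t : ℕ) : ℂ) +
        if i + e * r ≡ m [MOD e * t] then -(-1) ^ γ * (p : ℂ) ^ (j * γ) else 0 := by
    rw [← ht, ← hperiod]
    refine sum_congr rfl fun k _ => ?_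
    rw [ht]
    congr 2
    ring
  simp only [hterm]
  have ht0 : 0 < t := by
    rcases Nat.eq_zero_or_pos t with rfl | h
    · simp at ht
    · exact h
  have ht0' : (t : ℂ) ≠ 0 := by exact_mod_cast ht0.ne'
  have he0' : (e : ℂ) ≠ 0 := by exact_mod_cast he.ne'
  rw [sum_add_distrib, sum_const, card_range, nsmul_eq_mul]
  congr 1
  · push_cast
    field_simp
  · obtain ⟨s, rfl⟩ := hem
    split_ifs with hi0
    · subst hi0
      have (r : ℕ) (hr : r ∈ range t) : 0 + e * r ≡ e * s [MOD e * t] ↔ s % t = r := by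
        rw [zero_add, Nat.ModEq.mul_left_cancel_iff' he.ne', Nat.ModEq,
          Nat.mod_eq_of_lt (mem_range.mp hr), eq_comm]
      rw [sum_congr rfl fun r hr => if_congr (this r hr) rfl rfl, sum_ite_eq,
        if_pos (mem_range.mpr (Nat.mod_lt _ ht0))]
    · refine sum_eq_zero fun r _ => if_neg fun h => hi0 ?_
      have h' : (i + e * r) % e = (e * s) % e := h.of_mul_right t
      rwa [Nat.add_mul_mod_self_left, Nat.mul_mod_right, Nat.mod_eq_of_lt hi] at h'

/-- The canonical additive character of `GaloisField p n` as an `AddChar`. -/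
def psiAddChar (p n : ℕ) [Fact p.Prime] : AddChar (GaloisField p n) ℂ :=
  (ZMod.stdAddChar (N := p)).compAddMonoidHom
    (Algebra.trace (ZMod p) (GaloisField p n)).toAddMonoidHom

lemma psiAddChar_apply (p n : ℕ) [Fact p.Prime] (x : GaloisField p n) :
    psiAddChar p n x = ZMod.stdAddChar (Algebra.trace (ZMod p) (GaloisField p n) x) := rfl

lemma psiAddChar_eq_psi (p n : ℕ) [Fact p.Prime] (x : GaloisField p n) :
    psiAddChar p n x = psi p n x := by
  rw [psiAddChar_apply, ZMod.stdAddChar_apply, ZMod.toCircle_apply, psi]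

lemma isPrimitive_psiAddChar (p n : ℕ) [Fact p.Prime] : (psiAddChar p n).IsPrimitive := by
  refine AddChar.IsPrimitive.of_ne_one fun h => ?_
  obtain ⟨x, hx⟩ := Algebra.trace_surjective (ZMod p) (GaloisField p n) 1
  have h1 := DFunLike.congr_fun h x
  rw [psiAddChar_apply, hx, AddChar.one_apply,
    ← AddChar.map_zero_eq_one (ZMod.stdAddChar (N := p))] at h1
  exact one_ne_zero (ZMod.injective_stdAddChar h1)

lemma sum_cycClass {p n : ℕ} [Fact p.Prime] {u : (GaloisField p n)ˣ} {e f i : ℕ} (he : 0 < e)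
    (hef : e * f = orderOf u) :
    ∑ z ∈ cycClass p n (u : GaloisField p n) e f i, psi p n z =
      ∑ k ∈ range f, psiAddChar p n ((u : GaloisField p n) ^ (i + e * k)) := by
  rw [cycClass, sum_image]
  · simp only [psiAddChar_eq_psi]
  · intro a ha b hb h
    rw [coe_range, Set.mem_Iio] at ha hb
    have h1 : u ^ (i + e * a) = u ^ (i + e * b) := by ext; simpa using h
    rw [pow_add, pow_add, mul_right_inj] at h1
    have h2 := pow_injOn_Iio_orderOf (x := u) (by rw [Set.mem_Iio, ← hef]; gcongr)
      (by rw [Set.mem_Iio, ← hef]; gcongr) h1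
    exact Nat.eq_of_mul_eq_mul_left he h2

/-- **Theorem 2.2, Case B (uniform cyclotomy).**  Let `p` be a prime, `e ≥ 2`, `q = p^{2jγ}`
where `γ ≥ 1`, `e ∣ p^j + 1` and `j` is the smallest such positive integer.  If it is not the
case that `γ`, `p`, `(p^j+1)/e` are all odd, then the cyclotomic periods of order `e` of `F_q`
satisfy `η_0 = −(−1)^γ √q + ((−1)^γ √q − 1)/e` and `η_i = ((−1)^γ √q − 1)/e` for all `i ≠ 0`,
where `√q = p^{jγ}`. -/
theorem uniform_cyclotomy_case_B
    (p : ℕ) [Fact p.Prime] (e : ℕ) (he : 2 ≤ e)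
    (j : ℕ) (hj : 0 < j) (hje : e ∣ p ^ j + 1)
    (hjmin : ∀ j' : ℕ, 0 < j' → e ∣ p ^ j' + 1 → j ≤ j')
    (γ : ℕ) (hγ : 1 ≤ γ)
    (hcase : ¬(Odd γ ∧ Odd p ∧ Odd ((p ^ j + 1) / e)))
    (g : GaloisField p (2 * j * γ))
    (hg : ∀ x : GaloisField p (2 * j * γ), x ≠ 0 → ∃ k : ℕ, g ^ k = x) :
    (∑ z ∈ cycClass p (2 * j * γ) g e ((p ^ (2 * j * γ) - 1) / e) 0,
        psi p (2 * j * γ) z)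
        = -(-1 : ℂ) ^ γ * (p : ℂ) ^ (j * γ)
            + ((-1 : ℂ) ^ γ * (p : ℂ) ^ (j * γ) - 1) / e ∧
      ∀ i < e, i ≠ 0 →
        (∑ z ∈ cycClass p (2 * j * γ) g e ((p ^ (2 * j * γ) - 1) / e) i,
            psi p (2 * j * γ) z)
          = ((-1 : ℂ) ^ γ * (p : ℂ) ^ (j * γ) - 1) / e := by
  have hn : 2 * j * γ ≠ 0 := by positivity
  have hcard : Fintype.card (GaloisField p (2 * j * γ)) = p ^ (2 * j * γ) := by
    rw [← Nat.card_eq_fintype_card, GaloisField.card p _ hn]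
  have hcard4 : 4 ≤ p ^ (2 * j * γ) :=
    calc 4 = 2 ^ 2 := rfl
      _ ≤ p ^ 2 := Nat.pow_le_pow_left (Fact.out : p.Prime).two_le 2
      _ ≤ p ^ (2 * j * γ) := Nat.pow_le_pow_right (Fact.out : p.Prime).pos (by nlinarith)
  have hg0 : g ≠ 0 := by
    rintro rfl
    obtain ⟨x, -, hx⟩ := exists_mem_notMem_of_card_lt_card
      (s := ({0, 1} : Finset (GaloisField p (2 * j * γ)))) (t := univ)
      (card_le_two.trans_lt (by rw [card_univ, hcard]; omega))
    simp only [mem_insert, mem_singleton, not_or] at hx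
    obtain ⟨k, hk⟩ := hg x hx.1
    rcases Nat.eq_zero_or_pos k with rfl | hk'
    · exact hx.2 (by simpa using hk.symm)
    · exact hx.1 (by rw [← hk, zero_pow hk'.ne'])
  obtain ⟨u, rfl⟩ : ∃ u : (GaloisField p (2 * j * γ))ˣ, (u : GaloisField p (2 * j * γ)) = g :=
    ⟨Units.mk0 g hg0, rfl⟩
  have hu (x : (GaloisField p (2 * j * γ))ˣ) : ∃ k : ℕ, u ^ k = x := by
    obtain ⟨k, hk⟩ := hg x x.ne_zero
    exact ⟨k, by ext; simpa using hk⟩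
  have hord : orderOf u = p ^ (2 * j * γ) - 1 := by
    rw [orderOf_eq_card_of_forall_mem_zpowers fun x => by
      obtain ⟨k, rfl⟩ := hu x
      exact Subgroup.npow_mem_zpowers u k, Nat.card_eq_fintype_card, Fintype.card_units, hcard]
  have hdvd : e ∣ p ^ (2 * j * γ) - 1 := by
    rw [pow_two_mul_sub_one_eq_mul
      ((Fact.out : p.Prime).two_le.trans (Nat.le_self_pow hj.ne' p)) γ]
    exact (hje.mul_right _).mul_left _
  have hperiod {i : ℕ} (hi : i < e) := uniform_period (isPrimitive_psiAddChar p (2 * j * γ)) hj hγ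
    hje hcase hcard
    (fun x => by rw [psiAddChar_apply, psiAddChar_apply, trace_pow_char_pow])
    (fun z hz => by
      rw [psiAddChar_apply, trace_eq_zero_of_pow_eq_neg j γ (GaloisField.finrank p hn) hz,
        AddChar.map_zero_eq_one])
    hu hord hi
  have hclass (i : ℕ) := sum_cycClass (i := i) (by omega : 0 < e)
    ((Nat.mul_div_cancel' hdvd).trans hord.symm)
  refine ⟨?_, fun i hi hi0 => ?_⟩
  · rw [hclass, hperiod (by omega), if_pos rfl, add_comm]
  · rw [hclass, hperiod hi, if_neg hi0, add_zero]
end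
end

section
/- Let p be a prime, e ≥ 2, j the smallest positive integer such that e divides p^j + 1, q = p^{2jγ} with γ ≥ 1, f = (q−1)/e, and suppose it is NOT the case that γ, p, (p^j+1)/e are all odd. Let m ≥ 1, Q a nonsingular quadratic form on V = F_q^{2m} with polar form B, and ε ∈ {1,−1} such that ∑_{x∈V} ψ_1(αQ(x)) = ε q^m for every α ∈ F_q^×. Set D_C = {x ∈ V : Q(x) ∈ C_0}. Then for every b ∈ V with b ≠ 0: ∑_{x∈D_C} ψ_1(B(b,x)) = ε q^{m−1}(q−f) if −Q(b) ∈ C_0, and ∑_{x∈D_C} ψ_1(B(b,x)) = −ε q^{m−1} f otherwise. -/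
open Finset

noncomputable section
open scoped Classical

section Cyclic

variable {G : Type*} [CommGroup G] [IsCyclic G] [Fintype G]

/-- In a cyclic group, an `a`-torsion element is a `b`-th power as soon as `a * b` divides
the order. -/
theorem IsCyclic.exists_pow_eq_of_pow_eq_one {a b : ℕ} (hab : a * b ∣ Fintype.card G) {x : G}
    (hx : x ^ a = 1) : ∃ y : G, y ^ b = x := by
  obtain ⟨c, hc⟩ := hab
  have hpos : 0 < a := Nat.pos_of_ne_zero fun h => by
    simp [h] at hc
  obtain ⟨g, hg⟩ := IsCyclic.exists_generator (α := G)
  obtain ⟨k, rfl⟩ := (Submonoid.mem_powers_iff _ _).1 ((mem_powers_iff_mem_zpowers).2 (hg x))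
  have hord : orderOf g = a * b * c := by
    rw [← hc, ← Nat.card_eq_fintype_card, orderOf_eq_card_of_forall_mem_zpowers hg]
  rw [← pow_mul] at hx
  have h := orderOf_dvd_of_pow_eq_one hx
  rw [hord, show a * b * c = b * c * a by ring] at h
  obtain ⟨d, hd⟩ := Nat.dvd_of_mul_dvd_mul_right hpos h
  refine ⟨g ^ (c * d), ?_⟩
  rw [← pow_mul, hd]
  congr 1
  ring

theorem IsCyclic.card_filter_exists_pow_eq {d : ℕ}
    [DecidablePred fun x : G => ∃ y : G, y ^ d = x] (hd : d ∣ Fintype.card G) :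
    (univ.filter fun x : G => ∃ y : G, y ^ d = x).card = Fintype.card G / d := by
  have h := IsCyclic.card_powMonoidHom_range (G := G) d
  rw [Nat.card_eq_fintype_card, Nat.card_eq_fintype_card, Nat.gcd_eq_right hd] at h
  rw [← h, Fintype.card_subtype]
  congr 1 with x
  simp

theorem IsCyclic.card_filter_pow_eq_one [DecidableEq G] {d : ℕ} (hd : d ∣ Fintype.card G) :
    (univ.filter fun x : G => x ^ d = 1).card = d := by
  have h := IsCyclic.card_powMonoidHom_ker (G := G) d
  rw [Nat.card_eq_fintype_card, Nat.card_eq_fintype_card, Nat.gcd_eq_right hd] at h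
  refine Eq.trans ?_ h
  rw [Fintype.card_subtype]
  congr 1 with x
  simp [MonoidHom.mem_ker]

end Cyclic

section WeilSum

variable {K : Type*} [Field K] [Fintype K] {p : ℕ} [Fact p.Prime] {ψ : AddChar K ℂ}

theorem sum_eq_zero_add_sum_units {M : Type*} [AddCommMonoid M] (f : K → M) :
    ∑ x, f x = f 0 + ∑ x : Kˣ, f x := by
  rw [Fintype.sum_eq_add_sum_subtype_ne _ (0 : K),
    Equiv.sum_comp unitsEquivNeZero (fun x : {x : K // x ≠ 0} => f x) |>.symm]
  rfl

theorem AddChar.sum_mul_left (hψ : ψ.IsPrimitive) (b : K) :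
    ∑ x, ψ (b * x) = if b = 0 then (Fintype.card K : ℂ) else 0 := by
  have h := AddChar.sum_mulShift b hψ
  simp only [mul_comm b]
  rw [h]
  split_ifs <;> simp

theorem AddChar.sum_units_mul_left (hψ : ψ.IsPrimitive) (b : K) :
    ∑ x : Kˣ, ψ (b * x) = (if b = 0 then (Fintype.card K : ℂ) else 0) - 1 := by
  rw [← AddChar.sum_mul_left hψ, sum_eq_zero_add_sum_units fun x => ψ (b * x)]
  simp

/-- The Weil sum of the monomial `α x ^ n`. -/
def weilSum (ψ : AddChar K ℂ) (n : ℕ) (α : K) : ℂ := ∑ x, ψ (α * x ^ n)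

theorem weilSum_mul_pow (n : ℕ) (α : K) (c : Kˣ) :
    weilSum ψ n (α * (c : K) ^ n) = weilSum ψ n α := by
  unfold weilSum
  rw [← Equiv.sum_comp (Units.mulLeft c) fun x => ψ (α * x ^ n)]
  simp [mul_pow, mul_assoc]

theorem weilSum_eq_one_add_units {n : ℕ} (hn : n ≠ 0) (α : K) :
    weilSum ψ n α = 1 + ∑ x : Kˣ, ψ (α * (x : K) ^ n) := by
  rw [weilSum, sum_eq_zero_add_sum_units]
  simp [hn]

theorem sum_units_weilSum {n : ℕ} (hψ : ψ.IsPrimitive) (hn : n ≠ 0) :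
    ∑ α : Kˣ, weilSum ψ n α = 0 := by
  have hq : (Fintype.card Kˣ : ℂ) = Fintype.card K - 1 := by
    have := Fintype.card_eq_card_units_add_one (α := K)
    rw [this]; push_cast; ring
  have h1 (x : Kˣ) : ∑ α : Kˣ, ψ ((α : K) * (x : K) ^ n) = -1 := by
    have := AddChar.sum_units_mul_left hψ ((x : K) ^ n)
    simpa [mul_comm] using this
  simp_rw [weilSum_eq_one_add_units hn]
  rw [sum_add_distrib, sum_comm]
  simp [h1]

theorem conj_weilSum {n : ℕ} {ι : Kˣ} (hι : ι ^ n = -1) (α : K) :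
    (starRingEnd ℂ) (weilSum ψ n α) = weilSum ψ n α := by
  have hι' : (ι : K) ^ n = -1 := by rw [← Units.val_pow_eq_pow_val, hι]; simp
  refine Eq.trans ?_ (weilSum_mul_pow n α ι)
  rw [hι']
  unfold weilSum
  rw [map_sum]
  refine sum_congr rfl fun x _ => ?_
  rw [← AddChar.map_neg_eq_conj, mul_neg_one, neg_mul]

theorem pow_mul_pow_eq_neg_iff {j : ℕ} (hdvd : p ^ j * p ^ j - 1 ∣ Fintype.card Kˣ) {s t : Kˣ}
    (hst : s ^ p ^ j * t ^ (p ^ j * p ^ j) = -(s * t)) (α : Kˣ) :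
    (∃ z : Kˣ, α ^ p ^ j * z ^ (p ^ j * p ^ j) = -(α * z)) ↔
      ∃ y : Kˣ, y ^ (p ^ j + 1) = α / s := by
  obtain ⟨P, hP⟩ : ∃ P, p ^ j = P + 1 := Nat.exists_eq_succ_of_ne_zero (by
    have := (Fact.out : p.Prime).pos
    positivity)
  rw [hP] at hdvd hst ⊢
  have hdvd' : P * (P + 1 + 1) ∣ Fintype.card Kˣ := by
    convert hdvd using 1
    refine Nat.eq_sub_of_add_eq ?_
    ring
  have key (β w : Kˣ) : (s * β) ^ (P + 1) * (t * w) ^ ((P + 1) * (P + 1)) = -(s * β * (t * w)) ↔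
      (β * w ^ (P + 1 + 1)) ^ P = 1 := by
    have h1 : (s * β) ^ (P + 1) * (t * w) ^ ((P + 1) * (P + 1))
        = -(s * β * (t * w)) * (β * w ^ (P + 1 + 1)) ^ P := by
      have hst' := congrArg Units.val hst
      apply Units.ext
      push_cast at hst' ⊢
      linear_combination (β * w * (β * w ^ (P + 1 + 1)) ^ P : K) * hst'
    rw [h1, mul_eq_left]
  constructor
  · rintro ⟨z, hz⟩
    have h := (key (α / s) (z / t)).1 (by simpa using hz)
    obtain ⟨y, hy⟩ := IsCyclic.exists_pow_eq_of_pow_eq_one hdvd' h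
    refine ⟨y / (z / t), ?_⟩
    rw [div_pow, hy, mul_div_cancel_right]
  · rintro ⟨y, hy⟩
    refine ⟨t * y⁻¹, ?_⟩
    have h := (key (α / s) y⁻¹).2 (by rw [← hy, inv_pow, mul_inv_cancel, one_pow])
    simpa using h

theorem card_filter_pow_mul_pow_eq_neg {j : ℕ} (hdvd : p ^ j * p ^ j - 1 ∣ Fintype.card Kˣ)
    (α : Kˣ) :
    (univ.filter fun z : K => (α : K) ^ p ^ j * z ^ (p ^ j * p ^ j) = -(α * z)).card
      = if ∃ z : Kˣ, α ^ p ^ j * z ^ (p ^ j * p ^ j) = -(α * z) then p ^ j * p ^ j else 1 := by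
  have hp : 0 < p ^ j * p ^ j := by
    have := (Fact.out : p.Prime).pos
    positivity
  have hunits : (univ.filter fun z : K => (α : K) ^ p ^ j * z ^ (p ^ j * p ^ j) = -(α * z)).card
      = 1 + (univ.filter fun z : Kˣ => α ^ p ^ j * z ^ (p ^ j * p ^ j) = -(α * z)).card := by
    rw [card_filter, sum_eq_zero_add_sum_units, card_filter]
    congr 1
    · have := (Fact.out : p.Prime).ne_zero
      simp [this]
    · refine sum_congr rfl fun z _ => if_congr ?_ rfl rfl
      rw [Units.ext_iff]
      simp
  rw [hunits]
  split_ifs with h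
  · obtain ⟨z₀, h₀⟩ := h
    have hcard := IsCyclic.card_filter_pow_eq_one hdvd
    have : (univ.filter fun z : Kˣ => α ^ p ^ j * z ^ (p ^ j * p ^ j) = -(α * z)).card
        = (univ.filter fun z : Kˣ => z ^ (p ^ j * p ^ j - 1) = 1).card := by
      refine (card_equiv (Equiv.mulLeft z₀) fun w => ?_).symm
      simp only [mem_filter, mem_univ, true_and, Equiv.coe_mulLeft]
      rw [mul_pow, ← mul_assoc, h₀, neg_mul, neg_inj, ← mul_assoc, mul_right_inj,
        ← mul_eq_right (b := w), ← pow_succ, Nat.sub_add_cancel hp]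
    rw [this, hcard]
    omega
  · rw [filter_false_of_mem, card_empty]
    exact fun z _ hz => h ⟨z, hz⟩

variable [CharP K p]

theorem sum_frobenius_bilinear (hψ : ψ.IsPrimitive) {j : ℕ}
    (hfrob : ∀ x, ψ (x ^ p ^ j) = ψ x) (α z : K) :
    ∑ y, ψ (α * (y ^ p ^ j * z + z ^ p ^ j * y))
      = if α ^ p ^ j * z ^ (p ^ j * p ^ j) = -(α * z) then (Fintype.card K : ℂ) else 0 := by
  obtain ⟨β, hβ⟩ := (iterateFrobeniusEquiv K p j).surjective (α * z)
  rw [iterateFrobeniusEquiv_def] at hβ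
  have h (y : K) : ψ (α * (y ^ p ^ j * z + z ^ p ^ j * y)) = ψ ((β + α * z ^ p ^ j) * y) := by
    rw [show α * (y ^ p ^ j * z + z ^ p ^ j * y) = α * z * y ^ p ^ j + α * z ^ p ^ j * y by ring,
      ← hβ, ← mul_pow, add_mul, AddChar.map_add_eq_mul, AddChar.map_add_eq_mul, hfrob]
  simp_rw [h]
  rw [AddChar.sum_mul_left hψ]
  refine if_congr ?_ rfl rfl
  rw [← (iterateFrobenius_inj K p j).eq_iff, map_zero, map_add, iterateFrobenius_def,
    iterateFrobenius_def, hβ, mul_pow, ← pow_mul, add_comm, add_eq_zero_iff_eq_neg]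

theorem weilSum_sq (hψ : ψ.IsPrimitive) {j : ℕ} (hfrob : ∀ x, ψ (x ^ p ^ j) = ψ x)
    (hone : ∀ w, w ^ p ^ j = -w → ψ w = 1) {ι : Kˣ} (hι : ι ^ (p ^ j + 1) = -1) (α : K) :
    weilSum ψ (p ^ j + 1) α ^ 2 = Fintype.card K *
      (univ.filter fun z : K => α ^ p ^ j * z ^ (p ^ j * p ^ j) = -(α * z)).card := by
  have hι' : (ι : K) ^ (p ^ j + 1) = -1 := by rw [← Units.val_pow_eq_pow_val, hι]; simp
  have hneg : weilSum ψ (p ^ j + 1) α = ∑ y, ψ (-(α * y ^ (p ^ j + 1))) := by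
    rw [← weilSum_mul_pow _ α ι, hι']
    simp [weilSum]
  have hexp (y z : K) : ψ (α * (y + z) ^ (p ^ j + 1)) * ψ (-(α * y ^ (p ^ j + 1)))
      = ψ (α * z ^ (p ^ j + 1)) * ψ (α * (y ^ p ^ j * z + z ^ p ^ j * y)) := by
    rw [← AddChar.map_add_eq_mul, ← AddChar.map_add_eq_mul, pow_succ (y + z),
      add_pow_char_pow]
    congr 1
    ring
  calc weilSum ψ (p ^ j + 1) α ^ 2
      = ∑ y, ∑ x, ψ (α * x ^ (p ^ j + 1)) * ψ (-(α * y ^ (p ^ j + 1))) := by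
        rw [sq]
        nth_rw 2 [hneg]
        rw [weilSum, sum_mul_sum, sum_comm]
    _ = ∑ y, ∑ z, ψ (α * z ^ (p ^ j + 1)) * ψ (α * (y ^ p ^ j * z + z ^ p ^ j * y)) := by
        refine sum_congr rfl fun y _ => ?_
        rw [← Equiv.sum_comp (Equiv.addLeft y)]
        exact sum_congr rfl fun z _ => hexp y z
    _ = ∑ z, if α ^ p ^ j * z ^ (p ^ j * p ^ j) = -(α * z) then (Fintype.card K : ℂ) else 0 := by
        rw [sum_comm]
        refine sum_congr rfl fun z _ => ?_
        rw [← mul_sum, sum_frobenius_bilinear hψ hfrob]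
        split_ifs with h
        · rw [hone, one_mul]
          rw [mul_pow, ← pow_mul, add_mul, one_mul, pow_add, ← mul_assoc, h]
          ring
        · simp
    _ = _ := by
        rw [← sum_filter, sum_const, nsmul_eq_mul, mul_comm]

theorem exists_weilSum_eq (hψ : ψ.IsPrimitive) {j : ℕ} (hfrob : ∀ x, ψ (x ^ p ^ j) = ψ x)
    (hone : ∀ w, w ^ p ^ j = -w → ψ w = 1) {ι : Kˣ} (hι : ι ^ (p ^ j + 1) = -1)
    (hdvd : p ^ j * p ^ j - 1 ∣ Fintype.card Kˣ) {s t : Kˣ}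
    (hst : s ^ p ^ j * t ^ (p ^ j * p ^ j) = -(s * t)) :
    ∃ v : ℂ, v ^ 2 = Fintype.card K ∧ ∀ α : Kˣ, weilSum ψ (p ^ j + 1) α
      = if ∃ y : Kˣ, y ^ (p ^ j + 1) = α / s then v * (p : ℂ) ^ j else -v := by
  have hP : 0 < (p : ℝ) ^ j := by
    have := (Fact.out : p.Prime).pos
    positivity
  have hq : 0 < (Fintype.card K : ℝ) := by
    exact_mod_cast Fintype.card_pos
  choose r hr using fun α : Kˣ => Complex.conj_eq_iff_real.1 (conj_weilSum (ψ := ψ) hι (α : K))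
  have hsq (α : Kˣ) : r α ^ 2 = Fintype.card K *
      if ∃ y : Kˣ, y ^ (p ^ j + 1) = α / s then ((p : ℝ) ^ j) ^ 2 else 1 := by
    have h := weilSum_sq hψ hfrob hone hι (α : K)
    rw [card_filter_pow_mul_pow_eq_neg hdvd, hr,
      if_congr (pow_mul_pow_eq_neg_iff hdvd hst α) rfl rfl] at h
    apply Complex.ofReal_injective
    split_ifs at h ⊢ <;> push_cast at h ⊢ <;> rw [h]
    ring
  have hs : ∃ y : Kˣ, y ^ (p ^ j + 1) = s / s := ⟨1, by simp⟩
  set v := r s / (p : ℝ) ^ j with hv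
  have hv2 : v ^ 2 = Fintype.card K := by
    have h := hsq s
    rw [if_pos hs] at h
    rw [hv, div_pow, h]
    field_simp
  have hv0 : v ≠ 0 := by
    intro h
    rw [h, zero_pow two_ne_zero] at hv2
    exact hq.ne hv2
  have hspecial (α : Kˣ) (h : ∃ y : Kˣ, y ^ (p ^ j + 1) = α / s) : r α = v * (p : ℝ) ^ j := by
    obtain ⟨y, hy⟩ := h
    rw [hv, div_mul_cancel₀ _ hP.ne', ← Complex.ofReal_inj, ← hr, ← hr,
      ← weilSum_mul_pow _ (s : K) y, ← Units.val_pow_eq_pow_val, hy, ← Units.val_mul,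
      mul_div_cancel]
  have hdvd' : p ^ j + 1 ∣ Fintype.card Kˣ :=
    (Dvd.intro _ (Nat.mul_self_sub_mul_self_eq (p ^ j) 1).symm).trans hdvd
  have hcard : (univ.filter fun α : Kˣ => ∃ y : Kˣ, y ^ (p ^ j + 1) = α / s).card * (p ^ j + 1)
      = Fintype.card Kˣ := by
    rw [card_equiv (t := univ.filter fun α : Kˣ => ∃ y : Kˣ, y ^ (p ^ j + 1) = α)
      (Equiv.divRight s) (by simp), IsCyclic.card_filter_exists_pow_eq hdvd',
      Nat.div_mul_cancel hdvd']
  have hsum : ∑ α, r α = 0 := by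
    have h := sum_units_weilSum hψ (Nat.succ_ne_zero (p ^ j))
    simp_rw [Nat.succ_eq_add_one, hr] at h
    exact_mod_cast h
  have hzero : ∑ α, v * (r α + v -
      if ∃ y : Kˣ, y ^ (p ^ j + 1) = α / s then v * ((p : ℝ) ^ j + 1) else 0) = 0 := by
    rw [← mul_sum, sum_sub_distrib, sum_add_distrib, hsum, ← sum_filter, sum_const, sum_const,
      card_univ, ← hcard]
    simp
    right
    ring
  have hnonneg (α : Kˣ) : 0 ≤ v * (r α + v -
      if ∃ y : Kˣ, y ^ (p ^ j + 1) = α / s then v * ((p : ℝ) ^ j + 1) else 0) := by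
    split_ifs with h
    · rw [hspecial α h]
      exact le_of_eq (by ring)
    · have h2 := hsq α
      rw [if_neg h, mul_one, ← hv2] at h2
      nlinarith [sq_nonneg (r α + v)]
  have heach := (sum_eq_zero_iff_of_nonneg fun α _ => hnonneg α).1 hzero
  refine ⟨v, by exact_mod_cast congrArg (fun x : ℝ => (x : ℂ)) hv2, fun α => ?_⟩
  rw [hr]
  split_ifs with h
  · rw [hspecial α h]
    push_cast
    rfl
  · have h0 := heach α (mem_univ _)
    rw [if_neg h, sub_zero, mul_eq_zero, or_iff_right hv0] at h0
    rw [eq_neg_of_add_eq_zero_left h0]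
    push_cast
    rfl

/-- Uniform cyclotomy: the Gaussian periods of order `e` take only two values, the exceptional one
being attained at the class of `s`. -/
theorem exists_gaussPeriod_eq (hψ : ψ.IsPrimitive) {j : ℕ} (hfrob : ∀ x, ψ (x ^ p ^ j) = ψ x)
    (hone : ∀ w, w ^ p ^ j = -w → ψ w = 1) {ι : Kˣ} (hι : ι ^ (p ^ j + 1) = -1)
    (hdvd : p ^ j * p ^ j - 1 ∣ Fintype.card Kˣ) {s t : Kˣ}
    (hst : s ^ p ^ j * t ^ (p ^ j * p ^ j) = -(s * t)) {e : ℕ} (he : e ∣ p ^ j + 1)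
    (hs : ∃ y, y ^ e = s) :
    ∃ v : ℂ, v ^ 2 = Fintype.card K ∧ ∀ α : Kˣ,
      ∑ c ∈ univ.filter (fun c : Kˣ => ∃ y, y ^ e = c), ψ (α * c)
        = -(v + 1) / e + if ∃ y, y ^ e = α then v else 0 := by
  obtain ⟨v, hv, h⟩ := exists_weilSum_eq hψ hfrob hone hι hdvd hst
  refine ⟨v, hv, fun α => ?_⟩
  have hdvd' : p ^ j + 1 ∣ Fintype.card Kˣ :=
    (Dvd.intro _ (Nat.mul_self_sub_mul_self_eq (p ^ j) 1).symm).trans hdvd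
  have he0 : (e : ℂ) ≠ 0 := by
    rintro h0
    norm_cast at h0
    subst h0
    simp at he
  have hn0 : (Fintype.card Kˣ : ℂ) ≠ 0 := by
    exact_mod_cast Fintype.card_ne_zero
  have hmul {x y : Kˣ} (hy : ∃ z, z ^ e = y) : (∃ z, z ^ e = x * y) ↔ ∃ z, z ^ e = x := by
    obtain ⟨w, rfl⟩ := hy
    constructor
    · rintro ⟨z, hz⟩
      exact ⟨z / w, by rw [div_pow, hz, mul_div_cancel_right]⟩
    · rintro ⟨z, rfl⟩
      exact ⟨z * w, mul_pow _ _ _⟩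
  have hpow (x : Kˣ) : ∃ z, z ^ e = x ^ (p ^ j + 1) := by
    obtain ⟨d, hd⟩ := he
    exact ⟨x ^ d, by rw [hd, ← pow_mul, mul_comm]⟩
  set C := univ.filter (fun c : Kˣ => ∃ y, y ^ e = c) with hC
  have hCcard : (C.card : ℂ) = Fintype.card Kˣ / e := by
    rw [hC, IsCyclic.card_filter_exists_pow_eq (he.trans hdvd'),
      Nat.cast_div (he.trans hdvd') he0]
  have h1 : ∑ c ∈ C, weilSum ψ (p ^ j + 1) (α * c)
      = C.card + Fintype.card Kˣ * ∑ c ∈ C, ψ (α * c) := by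
    simp_rw [weilSum_eq_one_add_units (Nat.succ_ne_zero (p ^ j))]
    rw [sum_add_distrib, sum_comm, sum_const, nsmul_one, ← card_univ, ← nsmul_eq_mul, ← sum_const]
    congr 1
    refine sum_congr rfl fun x _ => sum_equiv (Equiv.mulRight (x ^ (p ^ j + 1))) ?_ ?_
    · intro c
      simp [hC, hmul (hpow x)]
    · intro c _
      simp [mul_assoc]
  have h2 : ∑ c ∈ C, weilSum ψ (p ^ j + 1) (α * c)
      = -(v * C.card) + if ∃ y, y ^ e = α then v * Fintype.card Kˣ else 0 := by
    have hterm (c : Kˣ) : weilSum ψ (p ^ j + 1) (α * c) = -v +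
        if ∃ y : Kˣ, y ^ (p ^ j + 1) = α * c / s then v * ((p : ℂ) ^ j + 1) else 0 := by
      rw [← Units.val_mul, h]
      split_ifs <;> ring
    simp_rw [hterm]
    rw [sum_add_distrib, sum_const, ← sum_filter, sum_const, nsmul_eq_mul, nsmul_eq_mul]
    congr 1
    · ring
    have hmem {c : Kˣ} (hc : ∃ y : Kˣ, y ^ (p ^ j + 1) = α * c / s) : ∃ y, y ^ e = α * c := by
      obtain ⟨y, hy⟩ := hc
      rw [← div_mul_cancel (α * c) s, hmul hs, ← hy]
      exact hpow y
    split_ifs with hα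
    · have : (C.filter fun c => ∃ y : Kˣ, y ^ (p ^ j + 1) = α * c / s).card * (p ^ j + 1)
          = Fintype.card Kˣ := by
        rw [card_equiv (t := univ.filter fun c : Kˣ => ∃ y : Kˣ, y ^ (p ^ j + 1) = c)
          ((Equiv.mulLeft α).trans (Equiv.divRight s)) ?_,
          IsCyclic.card_filter_exists_pow_eq hdvd', Nat.div_mul_cancel hdvd']
        intro c
        simp only [hC, mem_filter, mem_univ, true_and, Equiv.trans_apply, Equiv.coe_mulLeft,
          Equiv.divRight_apply, and_iff_right_iff_imp]
        intro hc
        have := hmem hc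
        rwa [mul_comm, hmul hα] at this
      rw [← this]
      push_cast
      ring
    · rw [filter_false_of_mem, card_empty]
      · simp
      · intro c hc hc'
        exact hα ((hmul (mem_filter.1 hc).2).1 (hmem hc'))
  have h3 := h1.symm.trans h2
  rw [hCcard] at h3
  apply mul_left_cancel₀ hn0
  rw [eq_sub_of_add_eq' h3]
  split_ifs <;> field_simp <;> ring

end WeilSum

theorem polarForm_comm {K V : Type*} [Field K] [AddCommGroup V] (Q : V → K) (x y : V) :
    polarForm Q x y = polarForm Q y x := by
  unfold polarForm
  rw [add_comm x y]
  ring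

section QuadraticForm

variable {K : Type*} [Field K] {ψ : AddChar K ℂ}
  {V : Type*} [AddCommGroup V] [Module K V] [Fintype V] {Q : V → K}

theorem sum_addChar_mul_add_polarForm (hQ : ∀ (a : K) x, Q (a • x) = a ^ 2 * Q x)
    (hBsmul : ∀ (a : K) x y, polarForm Q (a • x) y = a * polarForm Q x y)
    (a : Kˣ) (b : V) :
    ∑ x, ψ (a * Q x + polarForm Q b x)
      = ψ (-Q b * (a⁻¹ : Kˣ)) * ∑ x, ψ (a * Q x) := by
  rw [← Equiv.sum_comp (Equiv.addLeft ((a⁻¹ : K) • b)) fun x => ψ (a * Q x), mul_sum]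
  refine sum_congr rfl fun x _ => ?_
  have h := hBsmul (a⁻¹ : K) b x
  have hadd : Q ((a⁻¹ : K) • b + x)
      = (a⁻¹ : K) ^ 2 * Q b + Q x + (a⁻¹ : K) * polarForm Q b x := by
    rw [← h, ← hQ, polarForm]
    ring
  rw [← AddChar.map_add_eq_mul, Equiv.coe_addLeft, hadd, Units.val_inv_eq_inv_val]
  congr 1
  field_simp
  ring

theorem sum_addChar_polarForm (hψ : ψ.IsPrimitive)
    (hBadd : ∀ x y z, polarForm Q (x + y) z = polarForm Q x z + polarForm Q y z)
    (hBsmul : ∀ (a : K) x y, polarForm Q (a • x) y = a * polarForm Q x y)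
    (hBnd : ∀ x, (∀ y, polarForm Q x y = 0) → x = 0) {b : V} (hb : b ≠ 0) :
    ∑ x, ψ (polarForm Q b x) = 0 := by
  let φ : V →+ K := AddMonoidHom.mk' (polarForm Q b) fun x y => by
    rw [polarForm_comm Q b, hBadd, polarForm_comm Q x, polarForm_comm Q y]
  have hφ : ψ.compAddMonoidHom φ ≠ 1 := by
    intro h
    apply hb
    refine hBnd b fun y => ?_
    by_contra hy
    refine hψ hy (DFunLike.ext _ _ fun a => ?_)
    have h1 := DFunLike.congr_fun h (a • y)
    have h2 : φ (a • y) = polarForm Q b y * a := by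
      change polarForm Q b (a • y) = _
      rw [polarForm_comm Q, hBsmul, polarForm_comm Q, mul_comm]
    rw [AddChar.compAddMonoidHom_apply, h2] at h1
    simpa [AddChar.mulShift_apply] using h1
  exact AddChar.sum_eq_zero_of_ne_one hφ

variable [Fintype K]

/-- Character sums over the preimage under a quadratic form of a union of classes with two-valued
Gaussian periods. -/
theorem sum_addChar_polarForm_preimage (hψ : ψ.IsPrimitive)
    (hQ : ∀ (a : K) x, Q (a • x) = a ^ 2 * Q x)
    (hBadd : ∀ x y z, polarForm Q (x + y) z = polarForm Q x z + polarForm Q y z)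
    (hBsmul : ∀ (a : K) x y, polarForm Q (a • x) y = a * polarForm Q x y)
    (hBnd : ∀ x, (∀ y, polarForm Q x y = 0) → x = 0)
    {A : ℂ} (hA : ∀ α : K, α ≠ 0 → ∑ x, ψ (α * Q x) = A)
    {C : Finset Kˣ} (hC : ∀ c, -c⁻¹ ∈ C ↔ c ∈ C) {S : Finset K}
    (hS : ∀ x, x ∈ S ↔ ∃ c ∈ C, (c : K) = x)
    {v : ℂ} (hv : v ^ 2 = Fintype.card K) {e : ℂ} (he : e ≠ 0)
    (hcard : C.card = (Fintype.card K - 1) / e)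
    (hperiod : ∀ α : Kˣ, ∑ c ∈ C, ψ (α * c) = -(v + 1) / e + if α ∈ C then v else 0)
    {b : V} (hb : b ≠ 0) :
    Fintype.card K * ∑ x ∈ univ.filter (fun x => Q x ∈ S), ψ (polarForm Q b x)
      = A * ((if -Q b ∈ S then (Fintype.card K : ℂ) else 0) - C.card) := by
  have hind (x : V) : (if Q x ∈ S then (Fintype.card K : ℂ) else 0)
      = ∑ c ∈ C, ∑ a, ψ (a * (Q x - c)) := by
    have h (c : Kˣ) : ∑ a, ψ (a * (Q x - c)) = if Q x = c then (Fintype.card K : ℂ) else 0 := by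
      simp_rw [mul_comm _ (Q x - c), AddChar.sum_mul_left hψ, sub_eq_zero]
    simp_rw [h]
    split_ifs with hx
    · obtain ⟨c, hc, hcx⟩ := (hS _).1 hx
      rw [sum_eq_single_of_mem c hc, if_pos hcx.symm]
      intro d _ hd
      rw [if_neg]
      rw [← hcx]
      exact fun h => hd (Units.ext h.symm)
    · refine (sum_eq_zero fun c hc => if_neg ?_).symm
      exact fun h => hx ((hS _).2 ⟨c, hc, h.symm⟩)
  have hexpand : Fintype.card K * ∑ x ∈ univ.filter (fun x => Q x ∈ S), ψ (polarForm Q b x)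
      = ∑ a, ∑ c ∈ C, ψ (-(a * c)) * ∑ x, ψ (a * Q x + polarForm Q b x) := by
    calc Fintype.card K * ∑ x ∈ univ.filter (fun x => Q x ∈ S), ψ (polarForm Q b x)
        = ∑ x, (if Q x ∈ S then (Fintype.card K : ℂ) else 0) * ψ (polarForm Q b x) := by
          rw [mul_sum, sum_filter]
          exact sum_congr rfl fun x _ => by split_ifs <;> simp
      _ = ∑ x, ∑ a, ∑ c ∈ C, ψ (-(a * c)) * ψ (a * Q x + polarForm Q b x) := by
          refine sum_congr rfl fun x _ => ?_
          rw [hind, sum_comm, sum_mul]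
          refine sum_congr rfl fun a _ => ?_
          rw [sum_mul]
          refine sum_congr rfl fun c _ => ?_
          rw [← AddChar.map_add_eq_mul, ← AddChar.map_add_eq_mul]
          congr 1
          ring
      _ = _ := by
          rw [sum_comm]
          refine sum_congr rfl fun a _ => ?_
          rw [sum_comm]
          simp_rw [mul_sum]
  have hunit : Fintype.card K * ∑ x ∈ univ.filter (fun x => Q x ∈ S), ψ (polarForm Q b x)
      = A * ∑ a : Kˣ, (∑ c ∈ C, ψ ((-a : Kˣ) * c)) * ψ (-Q b * (a⁻¹ : Kˣ)) := by
    rw [hexpand, sum_eq_zero_add_sum_units]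
    simp only [zero_mul, zero_add, sum_addChar_polarForm hψ hBadd hBsmul hBnd hb, mul_zero,
      sum_const_zero]
    rw [mul_sum]
    refine sum_congr rfl fun a _ => ?_
    rw [sum_addChar_mul_add_polarForm hQ hBsmul, hA _ a.ne_zero, ← sum_mul]
    simp only [Units.val_neg, neg_mul]
    ring
  have hinner : ∑ a : Kˣ, (∑ c ∈ C, ψ ((-a : Kˣ) * c)) * ψ (-Q b * (a⁻¹ : Kˣ))
      = -(v + 1) / e * ((if -Q b = 0 then (Fintype.card K : ℂ) else 0) - 1)
        + v * ∑ c ∈ C, ψ (-Q b * c) := by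
    rw [← AddChar.sum_units_mul_left hψ, ← Equiv.sum_comp (Equiv.inv Kˣ)]
    simp only [Equiv.inv_apply, inv_inv, hperiod, hC, add_mul, sum_add_distrib, ite_mul, zero_mul,
      ← mul_sum, sum_ite_mem, univ_inter]
  rw [hunit, hinner]
  congr 1
  rcases eq_or_ne (-Q b) 0 with h0 | h0
  · have hnot : -Q b ∉ S := by
      rw [hS]
      rintro ⟨c, -, hc⟩
      exact c.ne_zero (hc.trans h0)
    rw [if_pos h0, if_neg hnot, h0]
    simp only [zero_mul, AddChar.map_zero_eq_one, sum_const, nsmul_one, hcard]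
    field_simp
    ring
  · have hmem : -Q b ∈ S ↔ Units.mk0 (-Q b) h0 ∈ C := by
      rw [hS]
      constructor
      · rintro ⟨c, hc, h⟩
        rwa [show Units.mk0 (-Q b) h0 = c from Units.ext h.symm]
      · exact fun h => ⟨_, h, rfl⟩
    have hp := hperiod (Units.mk0 (-Q b) h0)
    rw [Units.val_mk0] at hp
    rw [if_neg h0, hp, if_congr hmem rfl rfl, hcard, ← hv]
    split_ifs <;> field_simp <;> ring

end QuadraticForm

section Arithmetic

theorem Function.Antiperiodic.sum_range_eq_zero {M : Type*} [AddCommGroup M] {f : ℕ → M} {j : ℕ}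
    (hf : Function.Antiperiodic f j) (k : ℕ) : ∑ i ∈ range (2 * j * k), f i = 0 := by
  induction k with
  | zero => simp
  | succ k ih =>
    have hper : Function.Periodic f (2 * j * k) := by
      have := hf.periodic_two_mul.nat_mul k
      rwa [Nat.cast_id, mul_comm] at this
    rw [mul_add_one, sum_range_add, ih, zero_add, two_mul j, sum_range_add, ← sum_add_distrib]
    refine sum_eq_zero fun i _ => ?_
    rw [show (j + j) * k + i = i + 2 * j * k by ring,
      show (j + j) * k + (j + i) = i + j + 2 * j * k by ring, hper, hper, hf, add_neg_cancel]

theorem Nat.exists_odd_pow_odd_eq (h k : ℕ) :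
    ∃ l, (2 * h + 1) ^ (2 * k + 1) = 2 * h * (2 * l + 1) + 1 := by
  induction k with
  | zero => exact ⟨0, by ring⟩
  | succ k ih =>
    obtain ⟨l, hl⟩ := ih
    refine ⟨(2 * h ^ 2 + 2 * h) * (2 * l + 1) + l + h + 1, ?_⟩
    rw [show 2 * (k + 1) + 1 = 2 * k + 1 + 2 by ring, pow_add, hl]
    ring

end Arithmetic

section Exceptional

variable {K : Type*} [Field K] [Fintype K]

/-- `-1` is a `b`-th power when `2 * b` divides the order of the unit group. -/
theorem exists_pow_eq_neg_one {b : ℕ} (hb : 2 * b ∣ Fintype.card Kˣ) : ∃ y : Kˣ, y ^ b = -1 :=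
  IsCyclic.exists_pow_eq_of_pow_eq_one hb (by simp)

theorem card_units_eq {q : ℕ} (hK : Fintype.card K = q) : Fintype.card Kˣ = q - 1 := by
  rw [← hK, Fintype.card_eq_card_units_add_one (α := K), Nat.add_sub_cancel]

theorem mul_self_sub_one_dvd_card_units {P γ : ℕ} (hK : Fintype.card K = (P * P) ^ γ) :
    P * P - 1 ∣ Fintype.card Kˣ := by
  rw [card_units_eq hK]
  simpa using Nat.sub_dvd_pow_sub_pow (P * P) 1 γ

theorem exists_pow_add_one_eq_neg_one {P γ : ℕ} (hK : Fintype.card K = (P * P) ^ γ)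
    (h2 : Odd P ∨ (-1 : K) = 1) : ∃ ι : Kˣ, ι ^ (P + 1) = -1 := by
  rcases h2 with ⟨h, rfl⟩ | h
  · refine exists_pow_eq_neg_one (dvd_trans ?_ (mul_self_sub_one_dvd_card_units hK))
    refine ⟨h, Nat.sub_eq_of_eq_add ?_⟩
    ring
  · exact ⟨1, by rw [one_pow]; exact Units.ext (by simpa using h.symm)⟩

/-- The class on which the Gaussian periods are exceptional is the class of `e`-th powers, unless
`γ`, `P` and `(P + 1) / e` are all odd. -/
theorem exists_exceptional {P γ e : ℕ} (hK : Fintype.card K = (P * P) ^ γ)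
    (h2 : Odd P ∨ (-1 : K) = 1) (he : e ∣ P + 1)
    (hcase : ¬(Odd γ ∧ Odd P ∧ Odd ((P + 1) / e))) :
    ∃ s t : Kˣ, s ^ P * t ^ (P * P) = -(s * t) ∧ ∃ y, y ^ e = s := by
  have hdvd := mul_self_sub_one_dvd_card_units hK
  by_cases hP : Odd P
  · obtain ⟨h, rfl⟩ := id hP
    have hsq : (2 * h + 1) * (2 * h + 1) = 2 * (2 * h * (h + 1)) + 1 := by ring
    by_cases hγ : Odd γ
    · obtain ⟨k, rfl⟩ := id hγ
      obtain ⟨l, hl⟩ := Nat.exists_odd_pow_odd_eq (2 * h * (h + 1)) k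
      obtain ⟨d, hd⟩ : Even ((2 * h + 1 + 1) / e) := by
        rw [← Nat.not_odd_iff_even]
        exact fun h => hcase ⟨hγ, hP, h⟩
      have hde : h + 1 = d * e := by
        have := Nat.div_mul_cancel he
        rw [hd] at this
        linarith
      rw [hsq, hl] at hK
      have hN := card_units_eq hK
      rw [Nat.add_sub_cancel, mul_assoc] at hN
      obtain ⟨y, hy⟩ := exists_pow_eq_neg_one (K := K) hN.symm.dvd
      refine ⟨y ^ (h + 1), y ^ l, ?_, y ^ d, by rw [← pow_mul, hde]⟩
      rw [hsq, ← neg_one_mul, ← hy]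
      simp only [← pow_mul, ← pow_add]
      congr 1
      ring
    · obtain ⟨k, rfl⟩ := Nat.not_odd_iff_even.1 hγ
      rw [← two_mul, pow_mul, sq] at hK
      have hN : 2 * ((2 * h + 1) * (2 * h + 1) - 1) ∣ Fintype.card Kˣ := by
        refine dvd_trans ?_ (mul_self_sub_one_dvd_card_units hK)
        refine ⟨2 * h * (h + 1) + 1, ?_⟩
        rw [hsq, Nat.add_sub_cancel]
        refine Nat.sub_eq_of_eq_add ?_
        ring
      obtain ⟨t, ht⟩ := exists_pow_eq_neg_one hN
      refine ⟨1, t, ?_, 1, one_pow e⟩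
      rw [← Nat.sub_add_cancel (show 1 ≤ (2 * h + 1) * (2 * h + 1) by nlinarith), pow_succ t, ht]
      simp
  · have h1 := h2.resolve_left hP
    refine ⟨1, 1, ?_, 1, one_pow e⟩
    exact Units.ext (by simpa using h1.symm)

end Exceptional

section GaloisField

variable (p n : ℕ) [Fact p.Prime]

/-- The canonical additive character of the Galois field, bundled as an additive character. -/
def canonicalAddChar : AddChar (GaloisField p n) ℂ :=
  ZMod.stdAddChar.compAddMonoidHom
    (Algebra.trace (ZMod p) (GaloisField p n)).toAddMonoidHom

theorem canonicalAddChar_apply (x : GaloisField p n) :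
    canonicalAddChar p n x = ZMod.stdAddChar (Algebra.trace (ZMod p) (GaloisField p n) x) :=
  rfl

theorem psi_eq_canonicalAddChar : psi p n = canonicalAddChar p n := by
  funext x
  rw [canonicalAddChar_apply, ZMod.stdAddChar_apply, ZMod.toCircle_apply, psi]

theorem canonicalAddChar_isPrimitive : (canonicalAddChar p n).IsPrimitive := by
  refine AddChar.IsPrimitive.of_ne_one fun h => ?_
  obtain ⟨x, hx⟩ := Algebra.trace_surjective (ZMod p) (GaloisField p n) 1
  have h1 := DFunLike.congr_fun h x
  rw [canonicalAddChar_apply, hx, AddChar.one_apply,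
    ← (ZMod.stdAddChar (N := p)).map_zero_eq_one, ZMod.injective_stdAddChar.eq_iff] at h1
  exact one_ne_zero h1

theorem canonicalAddChar_pow (j : ℕ) (x : GaloisField p n) :
    canonicalAddChar p n (x ^ p ^ j) = canonicalAddChar p n x := by
  induction j with
  | zero => simp
  | succ j ih =>
    rw [← ih, canonicalAddChar_apply, canonicalAddChar_apply, pow_succ, pow_mul]
    have h := Algebra.trace_eq_of_algEquiv
      (FiniteField.frobeniusAlgEquivOfAlgebraic (ZMod p) (GaloisField p n)) (x ^ p ^ j)
    rw [FiniteField.coe_frobeniusAlgEquivOfAlgebraic, ZMod.card] at h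
    exact congrArg _ h

theorem canonicalAddChar_eq_one {j γ : ℕ} (hn : n = 2 * j * γ) (h0 : n ≠ 0)
    (w : GaloisField p n) (hw : w ^ p ^ j = -w) : canonicalAddChar p n w = 1 := by
  subst hn
  have hanti : Function.Antiperiodic (fun i => w ^ p ^ i) j := by
    intro i
    change w ^ p ^ (i + j) = -w ^ p ^ i
    rw [pow_add, mul_comm (p ^ i), pow_mul, hw]
    simpa [iterateFrobenius_def] using
      map_neg (iterateFrobenius (GaloisField p (2 * j * γ)) p i) w
  have h := FiniteField.algebraMap_trace_eq_sum_pow (ZMod p) (GaloisField p (2 * j * γ)) w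
  rw [GaloisField.finrank p h0, Nat.card_zmod] at h
  have h' := h.trans (hanti.sum_range_eq_zero γ)
  rw [map_eq_zero] at h'
  rw [canonicalAddChar_apply, h', AddChar.map_zero_eq_one]

theorem mem_cycClass_zero_iff {g : GaloisField p n} (hg : ∀ x, x ≠ 0 → ∃ k : ℕ, g ^ k = x)
    {e : ℕ} (hcard : 2 ≤ Fintype.card (GaloisField p n)ˣ)
    (he : e ∣ Fintype.card (GaloisField p n)ˣ) (x : GaloisField p n) :
    x ∈ cycClass p n g e (Fintype.card (GaloisField p n)ˣ / e) 0 ↔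
      ∃ c ∈ univ.filter (fun c : (GaloisField p n)ˣ => ∃ y, y ^ e = c),
        (c : GaloisField p n) = x := by
  have hg0 : g ≠ 0 := by
    rintro rfl
    have : ∀ u : (GaloisField p n)ˣ, u = 1 := fun u => by
      obtain ⟨k, hk⟩ := hg u u.ne_zero
      rcases eq_or_ne k 0 with rfl | h
      · exact Units.ext (by simpa using hk.symm)
      · rw [zero_pow h] at hk
        exact absurd hk.symm u.ne_zero
    have := Fintype.card_le_one_iff.2 fun a b => (this a).trans (this b).symm
    omega
  simp only [cycClass, mem_image, mem_range, zero_add, mem_filter, mem_univ, true_and]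
  constructor
  · rintro ⟨k, -, rfl⟩
    exact ⟨(Units.mk0 g hg0 ^ k) ^ e, ⟨_, rfl⟩, by simp [← pow_mul, mul_comm]⟩
  · rintro ⟨_, ⟨y, rfl⟩, rfl⟩
    obtain ⟨k, hk⟩ := hg y y.ne_zero
    have hf : 0 < Fintype.card (GaloisField p n)ˣ / e :=
      Nat.div_pos (Nat.le_of_dvd (by omega) he) (Nat.pos_of_dvd_of_pos he (by omega))
    have hord : g ^ (e * (Fintype.card (GaloisField p n)ˣ / e)) = 1 := by
      rw [Nat.mul_div_cancel' he]
      have h := congrArg Units.val (pow_card_eq_one (x := Units.mk0 g hg0))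
      rwa [Units.val_pow_eq_pow_val, Units.val_mk0, Units.val_one] at h
    refine ⟨k % (Fintype.card (GaloisField p n)ˣ / e), Nat.mod_lt _ hf, ?_⟩
    rw [Units.val_pow_eq_pow_val, ← hk, ← pow_mul, mul_comm k e]
    conv_rhs => rw [← Nat.mod_add_div k (Fintype.card (GaloisField p n)ˣ / e)]
    rw [mul_add, pow_add, ← mul_assoc, pow_mul _ (e * _), hord, one_pow, mul_one]

end GaloisField

/-- **Case B character sums.**  With uniform cyclotomy of order `e` on `F_q`, `q = p^{2jγ}`,
not all of `γ, p, (p^j+1)/e` odd, and `Q` a nonsingular quadratic form on `V = F_q^{2m}` of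
type `ε`, the set `D_C = {x ∈ V : Q(x) ∈ C_0}` satisfies, for every `b ≠ 0`:
`∑_{x∈D_C} ψ₁(B(b,x)) = ε q^{m−1}(q−f)` if `−Q(b) ∈ C_0`, and `= −ε q^{m−1} f` otherwise. -/
theorem character_values_case_B
    (p : ℕ) [Fact p.Prime] (e : ℕ) (he : 2 ≤ e)
    (j : ℕ) (hj : 0 < j) (hje : e ∣ p ^ j + 1)
    (hjmin : ∀ j' : ℕ, 0 < j' → e ∣ p ^ j' + 1 → j ≤ j')
    (γ : ℕ) (hγ : 1 ≤ γ)
    (hcase : ¬(Odd γ ∧ Odd p ∧ Odd ((p ^ j + 1) / e)))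
    (g : GaloisField p (2 * j * γ))
    (hg : ∀ x : GaloisField p (2 * j * γ), x ≠ 0 → ∃ k : ℕ, g ^ k = x)
    (m : ℕ) (hm : 1 ≤ m)
    (Q : (Fin (2 * m) → GaloisField p (2 * j * γ)) → GaloisField p (2 * j * γ))
    (hQ : ∀ (a : GaloisField p (2 * j * γ)) x, Q (a • x) = a ^ 2 * Q x)
    (hBadd : ∀ x y z, polarForm Q (x + y) z = polarForm Q x z + polarForm Q y z)
    (hBsmul : ∀ (a : GaloisField p (2 * j * γ)) x y,
      polarForm Q (a • x) y = a * polarForm Q x y)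
    (hBnd : ∀ x, (∀ y, polarForm Q x y = 0) → x = 0)
    (ε : ℤ) (hε : ε = 1 ∨ ε = -1)
    (hsum : ∀ α : GaloisField p (2 * j * γ), α ≠ 0 →
      ∑ x : Fin (2 * m) → GaloisField p (2 * j * γ), psi p (2 * j * γ) (α * Q x)
        = (ε : ℂ) * ((p : ℂ) ^ (2 * j * γ)) ^ m) :
    ∀ b : Fin (2 * m) → GaloisField p (2 * j * γ), b ≠ 0 →
      (-Q b ∈ cycClass p (2 * j * γ) g e ((p ^ (2 * j * γ) - 1) / e) 0 →
        ∑ x ∈ (Finset.univ.filter fun x =>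
            Q x ∈ cycClass p (2 * j * γ) g e ((p ^ (2 * j * γ) - 1) / e) 0),
            psi p (2 * j * γ) (polarForm Q b x)
          = (ε : ℂ) * ((p : ℂ) ^ (2 * j * γ)) ^ (m - 1)
              * ((p : ℂ) ^ (2 * j * γ) - (((p ^ (2 * j * γ) - 1) / e : ℕ) : ℂ))) ∧
      (-Q b ∉ cycClass p (2 * j * γ) g e ((p ^ (2 * j * γ) - 1) / e) 0 →
        ∑ x ∈ (Finset.univ.filter fun x =>
            Q x ∈ cycClass p (2 * j * γ) g e ((p ^ (2 * j * γ) - 1) / e) 0),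
            psi p (2 * j * γ) (polarForm Q b x)
          = -(ε : ℂ) * ((p : ℂ) ^ (2 * j * γ)) ^ (m - 1)
              * (((p ^ (2 * j * γ) - 1) / e : ℕ) : ℂ)) := by
  intro b hb
  have hn : 2 * j * γ ≠ 0 := by positivity
  have hp := (Fact.out : p.Prime)
  have hK : Fintype.card (GaloisField p (2 * j * γ)) = p ^ (2 * j * γ) := by
    rw [← Nat.card_eq_fintype_card, GaloisField.card p _ hn]
  have hK' : Fintype.card (GaloisField p (2 * j * γ)) = (p ^ j * p ^ j) ^ γ := by
    rw [hK, ← pow_add, ← pow_mul, two_mul]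
  have hN := card_units_eq hK
  have h2 : Odd (p ^ j) ∨ (-1 : GaloisField p (2 * j * γ)) = 1 := by
    rcases hp.eq_two_or_odd' with rfl | h
    · right
      exact CharTwo.neg_eq 1
    · exact Or.inl h.pow
  have hcase' : ¬(Odd γ ∧ Odd (p ^ j) ∧ Odd ((p ^ j + 1) / e)) := by
    rwa [Nat.odd_pow_iff hj.ne']
  have hdvd := mul_self_sub_one_dvd_card_units hK'
  have hPdvd : p ^ j + 1 ∣ Fintype.card (GaloisField p (2 * j * γ))ˣ :=
    (Dvd.intro _ (Nat.mul_self_sub_mul_self_eq (p ^ j) 1).symm).trans hdvd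
  have hedvd := hje.trans hPdvd
  have hcard2 : 2 ≤ Fintype.card (GaloisField p (2 * j * γ))ˣ :=
    he.trans (Nat.le_of_dvd Fintype.card_pos hedvd)
  have he0 : (e : ℂ) ≠ 0 := by
    exact_mod_cast (by omega : e ≠ 0)
  obtain ⟨ι, hι⟩ := exists_pow_add_one_eq_neg_one hK' h2
  obtain ⟨s, t, hst, hs⟩ := exists_exceptional hK' h2 hje hcase'
  have hψ := canonicalAddChar_isPrimitive p (2 * j * γ)
  obtain ⟨v, hv, hperiod⟩ := exists_gaussPeriod_eq hψ (canonicalAddChar_pow p _ j)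
    (canonicalAddChar_eq_one p _ rfl hn) hι hdvd hst hje hs
  set C := univ.filter (fun c : (GaloisField p (2 * j * γ))ˣ => ∃ y, y ^ e = c) with hC
  have hmemC (c : (GaloisField p (2 * j * γ))ˣ) : c ∈ C ↔ ∃ y, y ^ e = c := by simp [hC]
  have hCcard : C.card = (p ^ (2 * j * γ) - 1) / e := by
    rw [hC, IsCyclic.card_filter_exists_pow_eq hedvd, hN]
  have hCcard' : (C.card : ℂ) = (Fintype.card (GaloisField p (2 * j * γ)) - 1) / e := by
    rw [hCcard, ← hN, Nat.cast_div hedvd he0,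
      Fintype.card_eq_card_units_add_one (α := GaloisField p (2 * j * γ))]
    push_cast
    ring
  have hneg : ∃ z : (GaloisField p (2 * j * γ))ˣ, z ^ e = -1 := by
    obtain ⟨d, hd⟩ := hje
    refine ⟨ι ^ d, ?_⟩
    rw [← pow_mul]
    exact (congrArg (ι ^ ·) ((mul_comm d e).trans hd.symm)).trans hι
  have hCinv (c : (GaloisField p (2 * j * γ))ˣ) : -c⁻¹ ∈ C ↔ c ∈ C := by
    obtain ⟨z, hz⟩ := hneg
    rw [hmemC, hmemC]
    constructor
    · rintro ⟨y, hy⟩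
      exact ⟨z * y⁻¹, by rw [mul_pow, hz, inv_pow, hy]; simp⟩
    · rintro ⟨y, rfl⟩
      exact ⟨z * y⁻¹, by rw [mul_pow, hz, inv_pow]; simp⟩
  have hS := mem_cycClass_zero_iff p _ hg hcard2 hedvd
  rw [hN] at hS
  rw [psi_eq_canonicalAddChar] at hsum ⊢
  simp only [← hmemC] at hperiod
  have key := sum_addChar_polarForm_preimage hψ hQ hBadd hBsmul hBnd hsum hCinv hS hv he0 hCcard'
    hperiod hb
  have hq0 : (p : ℂ) ^ (2 * j * γ) ≠ 0 := pow_ne_zero _ (by exact_mod_cast hp.ne_zero)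
  obtain ⟨m, rfl⟩ := Nat.exists_eq_add_of_le' hm
  rw [hK, hCcard, Nat.cast_pow, pow_succ] at key
  rw [Nat.add_sub_cancel]
  constructor
  · intro h
    rw [if_pos h] at key
    apply mul_left_cancel₀ hq0
    rw [key]
    ring
  · intro h
    rw [if_neg h] at key
    apply mul_left_cancel₀ hq0
    rw [key]
    ring
end
end
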